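/- Let L ⊆ Trees(Σ) be a regular tree language and let W_L = {[t,π] : π is a root-to-leaf path in some t ∈ L} ⊆ [Σ]*. Then L is a universal path language if and only if L = A W_L; moreover, in that case W_L is a regular word language. -/

import Mathlib

set_option autoImplicit false

/-! ## Trees over a ranked alphabet -/

/-- Trees over a ranked alphabet: a type `S` of letters together with an arity
function `ar : S → ℕ`; a node labelled `a` has exactly `ar a` (ordered) children. -/
inductive RTree (S : Type) (ar : S → ℕ) : Type where
  | node (a : S) (children : Fin (ar a) → RTree S ar) : RTree S ar

/-! ## Algebras -/

/-- An (unindexed) algebra structure on a carrier `α`: for every arity `n`,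
a set of `n`-ary operations on `α`. -/
structure AlgStr (α : Type) where
  ops : (n : ℕ) → Set ((Fin n → α) → α)

/-- A finite algebra: finite carrier and finitely many operations. -/
def FiniteAlg {α : Type} (A : AlgStr α) : Prop :=
  Finite α ∧ Finite ((n : ℕ) × {f : (Fin n → α) → α // f ∈ A.ops n})

/-- `h : Trees(Σ) → α` is a homomorphism into the algebra `A`:
for every letter there is an operation of `A` (of the right arity) commuting with `h`. -/
def IsHom {S : Type} {ar : S → ℕ} {α : Type} (A : AlgStr α) (h : RTree S ar → α) : Prop :=
  ∀ a : S, ∃ f ∈ A.ops (ar a), ∀ ts : Fin (ar a) → RTree S ar,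
    h (RTree.node a ts) = f (fun i => h (ts i))

/-- A tree language is recognised by an algebra if it is the preimage of a subset of
the carrier under some homomorphism into the algebra. -/
def Recognises {S : Type} {ar : S → ℕ} {α : Type} (A : AlgStr α) (L : Set (RTree S ar)) : Prop :=
  ∃ h : RTree S ar → α, IsHom A h ∧ ∃ F : Set α, L = h ⁻¹' F

/-- A tree language is regular if it is recognised by some finite algebra. -/
def TreeRegular {S : Type} {ar : S → ℕ} (L : Set (RTree S ar)) : Prop :=
  ∃ (α : Type) (A : AlgStr α), FiniteAlg A ∧ Recognises A L

/-! ## Contexts, derivatives and the syntactic congruence -/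

/-- A context: a term over `Σ` with exactly one occurrence of the hole variable. -/
inductive TCtx (S : Type) (ar : S → ℕ) : Type where
  | hole : TCtx S ar
  | node (a : S) (i : Fin (ar a)) (c : TCtx S ar)
      (other : (j : Fin (ar a)) → j ≠ i → RTree S ar) : TCtx S ar

/-- Substituting a tree for the hole of a context. -/
def TCtx.plug {S : Type} {ar : S → ℕ} : TCtx S ar → RTree S ar → RTree S ar
  | .hole, t => t
  | .node a i c other, t => RTree.node a (fun j => if h : j = i then c.plug t else other j h)

/-- `D` is a derivative of `L`: `D = {t : p[t] ∈ L}` for some context `p`. -/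
def IsDerivative {S : Type} {ar : S → ℕ} (L D : Set (RTree S ar)) : Prop :=
  ∃ p : TCtx S ar, D = {t | p.plug t ∈ L}

/-- The syntactic congruence relation of `L`: `t` and `t'` belong to exactly the same
derivatives of `L`. -/
def synRel {S : Type} {ar : S → ℕ} (L : Set (RTree S ar)) (t t' : RTree S ar) : Prop :=
  ∀ p : TCtx S ar, p.plug t ∈ L ↔ p.plug t' ∈ L

/-- The syntactic congruence of `L`, as a setoid. -/
def synSetoid {S : Type} {ar : S → ℕ} (L : Set (RTree S ar)) : Setoid (RTree S ar) :=
  ⟨synRel L, ⟨fun _ _ => Iff.rfl, fun h p => (h p).symm, fun h h' p => (h p).trans (h' p)⟩⟩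

/-- The syntactic algebra of `L`: the quotient of the tree algebra by the syntactic
congruence, with the operations induced by the tree-building operations. -/
def synAlg {S : Type} {ar : S → ℕ} (L : Set (RTree S ar)) :
    AlgStr (Quotient (synSetoid L)) where
  ops n := { g | ∃ (a : S) (h : ar a = n), ∀ us : Fin n → RTree S ar,
      g (fun i => Quotient.mk (synSetoid L) (us i))
        = Quotient.mk (synSetoid L) (RTree.node a (fun j => us (Fin.cast h j))) }

/-- The syntactic homomorphism: the quotient map onto the syntactic algebra. -/
def synMap {S : Type} {ar : S → ℕ} (L : Set (RTree S ar)) (t : RTree S ar) :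
    Quotient (synSetoid L) :=
  Quotient.mk (synSetoid L) t

/-! ## Boolean combinations -/

/-- Finite Boolean combinations of sets from a family `G`. -/
inductive BoolComb {X : Type} (G : Set (Set X)) : Set X → Prop where
  | base {s : Set X} : s ∈ G → BoolComb G s
  | compl {s : Set X} : BoolComb G s → BoolComb G sᶜ
  | union {s t : Set X} : BoolComb G s → BoolComb G t → BoolComb G (s ∪ t)
  | inter {s t : Set X} : BoolComb G s → BoolComb G t → BoolComb G (s ∩ t)

/-! ## Polynomial operations and the matrix power -/

/-- Terms built from the operations of `A`, variables (among `m` of them) and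
constants for elements of the carrier. -/
inductive PolyTerm {α : Type} (A : AlgStr α) (m : ℕ) : Type where
  | var (i : Fin m)
  | const (c : α)
  | app (n : ℕ) (f : (Fin n → α) → α) (hf : f ∈ A.ops n) (args : Fin n → PolyTerm A m)

/-- Evaluation of a polynomial term under a valuation of the variables. -/
def PolyTerm.eval {α : Type} {A : AlgStr α} {m : ℕ} : PolyTerm A m → (Fin m → α) → α
  | .var i, xs => xs i
  | .const c, _ => c
  | .app _ f _ args, xs => f (fun j => (args j).eval xs)

/-- `Pol A m`: the `m`-ary polynomial operations of `A`. -/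
def Pol {α : Type} (A : AlgStr α) (m : ℕ) : Set ((Fin m → α) → α) :=
  { g | ∃ p : PolyTerm A m, ∀ xs, g xs = p.eval xs }

/-- The algebra on the same carrier whose operations are all polynomial operations of `A`. -/
def polAlg {α : Type} (A : AlgStr α) : AlgStr α :=
  ⟨fun n => Pol A n⟩

/-- Concatenation of `k` many `n`-tuples into one `n·k`-tuple. -/
def concatTuples {α : Type} (n k : ℕ) (as : Fin k → Fin n → α) : Fin (n * k) → α :=
  fun j => as (finProdFinEquiv.symm j).2 (finProdFinEquiv.symm j).1

/-- The `n`-th matrix power of `A`: carrier `αⁿ`, and the `k`-ary operations are exactly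
those given coordinatewise by `n`-tuples of `n·k`-ary polynomial operations of `A`
applied to the concatenation of the `k` argument `n`-tuples. -/
def matrixPower {α : Type} (A : AlgStr α) (n : ℕ) : AlgStr (Fin n → α) where
  ops k := { G | ∃ fs : Fin n → ((Fin (n * k) → α) → α),
      (∀ i, fs i ∈ Pol A (n * k)) ∧
      ∀ as : Fin k → Fin n → α, G as = fun i => fs i (concatTuples n k as) }

/-! ## Division of algebras -/

/-- `A` divides `B`: `A` is (isomorphic to) a quotient of a subalgebra of a reduct
of `B`. Concretely: there is a subset of the carrier of `B` and a surjection `φ` onto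
the carrier of `A` such that every operation of `A` is induced via `φ` by some
operation of `B` under which the subset is closed. -/
def Divides {α β : Type} (A : AlgStr α) (B : AlgStr β) : Prop :=
  ∃ (C : Set β) (φ : C → α), Function.Surjective φ ∧
    ∀ n : ℕ, ∀ f ∈ A.ops n, ∃ g ∈ B.ops n,
      ∃ hcl : ∀ xs : Fin n → C, g (fun i => (xs i).1) ∈ C,
        ∀ xs : Fin n → C, φ ⟨g (fun i => (xs i).1), hcl xs⟩ = f (fun i => φ (xs i))

/-! ## Terms, tree homomorphisms and top-down transducers -/

/-- Terms over a ranked alphabet `(G, arG)` with variables from `X`. -/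
inductive TTerm (G : Type) (arG : G → ℕ) (X : Type) : Type where
  | var (x : X)
  | node (b : G) (ts : Fin (arG b) → TTerm G arG X)

/-- Substituting trees for the variables of a term. -/
def TTerm.subst {G : Type} {arG : G → ℕ} {X : Type} (σ : X → RTree G arG) :
    TTerm G arG X → RTree G arG
  | .var x => σ x
  | .node b ts => RTree.node b (fun i => (ts i).subst σ)

/-- A tree homomorphism datum: a term `t_a` over `Γ` with `ar a` variables for each `a ∈ Σ`. -/
def TreeHomData (S : Type) (arS : S → ℕ) (G : Type) (arG : G → ℕ) : Type :=
  (a : S) → TTerm G arG (Fin (arS a))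

/-- Applying a tree homomorphism: recursively replace each node labelled `a`
by the term `t_a` applied to the images of its subtrees. -/
def applyTreeHom {S : Type} {arS : S → ℕ} {G : Type} {arG : G → ℕ}
    (θ : TreeHomData S arS G arG) : RTree S arS → RTree G arG
  | .node a ts => (θ a).subst (fun i => applyTreeHom θ (ts i))

/-- A relabeling: an arity-preserving map of alphabets, lifted to trees. -/
def relabelMap {S S' : Type} {ar : S → ℕ} {ar' : S' → ℕ}
    (f : S' → S) (hf : ∀ a, ar' a = ar (f a)) : RTree S' ar' → RTree S ar
  | .node a ts => RTree.node (f a) (fun i => relabelMap f hf (ts (Fin.cast (hf a).symm i)))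

/-- A deterministic top-down tree transducer with input alphabet `(S, arS)`,
output alphabet `(G, arG)` and states `Q`. -/
structure DTOP (S : Type) (arS : S → ℕ) (G : Type) (arG : G → ℕ) (Q : Type) where
  init : Q
  δ : (a : S) → Q → TTerm G arG (Q × Fin (arS a))

/-- The semantics of a dtop, parametrised by the state it is started in. -/
def DTOP.run {S : Type} {arS : S → ℕ} {G : Type} {arG : G → ℕ} {Q : Type}
    (d : DTOP S arS G arG Q) : RTree S arS → Q → RTree G arG
  | .node a ts => fun q => (d.δ a q).subst (fun p => d.run (ts p.2) p.1)

/-! ## Path languages -/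

/-- The path alphabet `[Σ]`: leaf letters, and pairs (letter, child number). -/
def PathLetter (S : Type) (ar : S → ℕ) : Type :=
  {a : S // ar a = 0} ⊕ ((a : S) × Fin (ar a))

/-- `IsPathWord t w`: `w` is the word over `[Σ]` determined by some root-to-leaf
path of `t`. -/
inductive IsPathWord {S : Type} {ar : S → ℕ} : RTree S ar → List (PathLetter S ar) → Prop where
  | leaf (a : S) (h : ar a = 0) (ts : Fin (ar a) → RTree S ar) :
      IsPathWord (RTree.node a ts) [Sum.inl ⟨a, h⟩]
  | step (a : S) (ts : Fin (ar a) → RTree S ar) (i : Fin (ar a))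
      (w : List (PathLetter S ar)) :
      IsPathWord (ts i) w → IsPathWord (RTree.node a ts) (Sum.inr ⟨a, i⟩ :: w)

/-- A regular word language: one accepted by a DFA with finitely many states. -/
def RegularWordLang {A : Type} (W : Set (List A)) : Prop :=
  ∃ (Q : Type) (_ : Finite Q) (M : DFA A Q), ∀ w, w ∈ W ↔ w ∈ M.accepts

/-- `AW W`: the trees all of whose root-to-leaf path words belong to `W`. -/
def AW {S : Type} {ar : S → ℕ} (W : Set (List (PathLetter S ar))) : Set (RTree S ar) :=
  { t | ∀ w, IsPathWord t w → w ∈ W }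

/-- A universal path language: `AW W` for some regular word language `W`. -/
def IsUniversalPathLang {S : Type} {ar : S → ℕ} (L : Set (RTree S ar)) : Prop :=
  ∃ W : Set (List (PathLetter S ar)), RegularWordLang W ∧ L = AW W

/-- The set of path words of trees in `L`. -/
def pathWordsOf {S : Type} {ar : S → ℕ} (L : Set (RTree S ar)) :
    Set (List (PathLetter S ar)) :=
  { w | ∃ t ∈ L, IsPathWord t w }

/-! ## Some concrete algebras and the Boolean alphabet -/

/-- The two-element semi-lattice `(2, ∧)`. -/
def semilatticeAlg : AlgStr Bool where
  ops n := match n with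
    | 2 => {fun v => v 0 && v 1}
    | _ => ∅

/-- The semi-lattice with constants, `(2, ∧, 0, 1)`. -/
def semilattice01Alg : AlgStr Bool where
  ops n := match n with
    | 2 => {fun v => v 0 && v 1}
    | 0 => {fun _ => false, fun _ => true}
    | _ => ∅

/-- The two-element Boolean algebra `(2, ∨, ∧, ¬)`. -/
def boolAlg : AlgStr Bool where
  ops n := match n with
    | 2 => {fun v => v 0 || v 1, fun v => v 0 && v 1}
    | 1 => {fun v => !v 0}
    | _ => ∅

/-- The ranked alphabet `{∧, 0, 1}`. -/
inductive BLet : Type where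
  | band : BLet
  | bzero : BLet
  | bone : BLet

/-- Arities in `{∧, 0, 1}`: `∧` is binary, `0` and `1` are nullary. -/
def BLet.ar : BLet → ℕ
  | .band => 2
  | .bzero => 0
  | .bone => 0

/-- Evaluating a tree over `{∧, 0, 1}` as a Boolean formula. -/
def evalB : RTree BLet BLet.ar → Bool
  | .node .band ts => evalB (ts (0 : Fin 2)) && evalB (ts (1 : Fin 2))
  | .node .bzero _ => false
  | .node .bone _ => true

/-- The ranked alphabet whose letters are the operations of an algebra. -/
def OpsAlphabet {α : Type} (A : AlgStr α) : Type :=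
  (n : ℕ) × {f : (Fin n → α) → α // f ∈ A.ops n}

/-- Bottom-up evaluation of a tree of operations of `A` in `A`. -/
def evalOps {α : Type} (A : AlgStr α) : RTree (OpsAlphabet A) (fun g => g.1) → α
  | .node g ts => g.2.1 (fun i => evalOps A (ts i))

/-! ## Wreath products and nesting -/

/-- The wreath product `A ∘ B`. -/
def wreath {α β : Type} (A : AlgStr α) (B : AlgStr β) : AlgStr (α × β) where
  ops n := { F | ∃ f ∈ B.ops n, ∃ am : β → ((Fin n → α) → α),
      (∀ b, am b ∈ A.ops n) ∧
      ∀ xs : Fin n → α × β,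
        F xs = (am (f fun i => (xs i).2) (fun i => (xs i).1), f fun i => (xs i).2) }

/-- Annotating each node of a tree with the value of `h` on the subtree rooted there. -/
def annotate {S : Type} {ar : S → ℕ} {β : Type} (h : RTree S ar → β) :
    RTree S ar → RTree (S × β) (fun p => ar p.1)
  | .node a ts => RTree.node (a, h (RTree.node a ts)) (fun i => annotate h (ts i))

/-- `t^{L₁,…,Lₙ}`: annotate each node with the bit vector of memberships of its
subtree in the languages `Ls`. -/
noncomputable def nestAnnotate {S : Type} {ar : S → ℕ} {n : ℕ}
    (Ls : Fin n → Set (RTree S ar)) :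
    RTree S ar → RTree (S × (Fin n → Bool)) (fun p => ar p.1) :=
  annotate (fun u j => @decide (u ∈ Ls j) (Classical.propDecidable _))

/-- A class of tree languages (one family per ranked alphabet). -/
def LangClass : Type 1 :=
  ∀ (S : Type) (ar : S → ℕ), Set (Set (RTree S ar))

/-- Closure of a class of tree languages under nesting. -/
def ClosedUnderNesting (𝓛 : LangClass) : Prop :=
  ∀ (S : Type) [Finite S] (ar : S → ℕ) (n : ℕ) (Ls : Fin n → Set (RTree S ar))
    (L : Set (RTree (S × (Fin n → Bool)) (fun p => ar p.1))),
    (∀ j, Ls j ∈ 𝓛 S ar) → L ∈ 𝓛 (S × (Fin n → Bool)) (fun p => ar p.1) →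
    { t | nestAnnotate Ls t ∈ L } ∈ 𝓛 S ar

/-- The least class of algebras containing `𝒜` and closed under wreath products. -/
inductive WClosure (𝒜 : ∀ α : Type, AlgStr α → Prop) : ∀ α : Type, AlgStr α → Prop where
  | base {α : Type} {A : AlgStr α} : 𝒜 α A → WClosure 𝒜 α A
  | wreath {α β : Type} {A : AlgStr α} {B : AlgStr β} :
      WClosure 𝒜 α A → WClosure 𝒜 β B → WClosure 𝒜 (α × β) (wreath A B)

/-- The tree languages (over a fixed alphabet) recognised by algebras from a class. -/
def LangOf (𝒞 : ∀ α : Type, AlgStr α → Prop) (S : Type) (ar : S → ℕ) :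
    Set (Set (RTree S ar)) :=
  { L | ∃ (α : Type) (A : AlgStr α), 𝒞 α A ∧ Recognises A L }

theorem isPathWord_leaf_cons {S : Type} {ar : S → ℕ} {t : RTree S ar}
    {l : {a : S // ar a = 0}} {w : List (PathLetter S ar)} :
    IsPathWord t (Sum.inl l :: w) ↔ w = [] ∧ ∃ ts, t = RTree.node l.1 ts := by
  constructor
  · rintro ⟨a, h, ts⟩
    exact ⟨rfl, ts, rfl⟩
  · rintro ⟨rfl, ts, rfl⟩
    exact .leaf l.1 l.2 ts

theorem isPathWord_step_cons {S : Type} {ar : S → ℕ} {t : RTree S ar}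
    {p : (a : S) × Fin (ar a)} {w : List (PathLetter S ar)} :
    IsPathWord t (Sum.inr p :: w) ↔
      ∃ ts, t = RTree.node p.1 ts ∧ IsPathWord (ts p.2) w := by
  constructor
  · rintro (_ | ⟨a, ts, i, _, h⟩)
    exact ⟨ts, rfl, h⟩
  · rintro ⟨ts, rfl, h⟩
    exact .step p.1 ts p.2 w h

theorem not_isPathWord_nil {S : Type} {ar : S → ℕ} (t : RTree S ar) :
    ¬ IsPathWord t [] := nofun

/-- The automaton for the path words of `h ⁻¹' F`. In state `inl X` the subtree at the
current node may take exactly the values in `X`; the states `inr p` are reached after a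
leaf letter. -/
def pathDFA {S : Type} {ar : S → ℕ} {α : Type} (h : RTree S ar → α) (F : Set α) :
    DFA (PathLetter S ar) (Set α ⊕ Prop) where
  step
    | .inl X, .inl l => .inr (∃ ts, h (RTree.node l.1 ts) ∈ X)
    | .inl X, .inr p => .inl {x | ∃ ts, h (RTree.node p.1 ts) ∈ X ∧ h (ts p.2) = x}
    | .inr _, _ => .inr False
  start := .inl F
  accept := {s | Sum.elim (fun _ => False) id s}

theorem pathDFA_evalFrom_inr {S : Type} {ar : S → ℕ} {α : Type} (h : RTree S ar → α)
    (F : Set α) (w : List (PathLetter S ar)) (p : Prop) :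
    (pathDFA h F).evalFrom (.inr p) w ∈ (pathDFA h F).accept ↔ p ∧ w = [] := by
  induction w generalizing p with
  | nil => simp [pathDFA]
  | cons l w ih =>
    rw [DFA.evalFrom_cons]
    change (pathDFA h F).evalFrom (.inr False) w ∈ _ ↔ _
    simp [ih]

theorem pathDFA_evalFrom_inl {S : Type} {ar : S → ℕ} {α : Type} {A : AlgStr α}
    {h : RTree S ar → α} (hh : IsHom A h) (F : Set α) (w : List (PathLetter S ar))
    (X : Set α) :
    (pathDFA h F).evalFrom (.inl X) w ∈ (pathDFA h F).accept ↔
      ∃ t, h t ∈ X ∧ IsPathWord t w := by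
  induction w generalizing X with
  | nil => simp [pathDFA, not_isPathWord_nil]
  | cons l w ih =>
    rw [DFA.evalFrom_cons]
    rcases l with l | p
    · change (pathDFA h F).evalFrom (.inr (∃ ts, h (RTree.node l.1 ts) ∈ X)) w ∈ _ ↔ _
      rw [pathDFA_evalFrom_inr]
      simp only [isPathWord_leaf_cons]
      constructor
      · rintro ⟨⟨ts, hts⟩, hw⟩
        exact ⟨_, hts, hw, ts, rfl⟩
      · rintro ⟨_, hts, hw, ts, rfl⟩
        exact ⟨⟨ts, hts⟩, hw⟩
    · change (pathDFA h F).evalFrom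
        (.inl {x | ∃ ts, h (RTree.node p.1 ts) ∈ X ∧ h (ts p.2) = x}) w ∈ _ ↔ _
      rw [ih]
      simp only [isPathWord_step_cons]
      constructor
      · rintro ⟨s, ⟨ts, hts, hs⟩, hw⟩
        refine ⟨_, ?_, Function.update ts p.2 s, rfl, by simpa using hw⟩
        obtain ⟨f, -, hf⟩ := hh p.1
        rw [hf] at hts ⊢
        convert hts using 3 with i
        by_cases hi : i = p.2
        · subst hi
          simp [hs]
        · simp [hi]
      · rintro ⟨_, hts, ts, rfl, hw⟩
        exact ⟨ts p.2, ⟨ts, hts, rfl⟩, hw⟩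

theorem TreeRegular.regularWordLang_pathWordsOf {S : Type} {ar : S → ℕ}
    {L : Set (RTree S ar)} (hL : TreeRegular L) : RegularWordLang (pathWordsOf L) := by
  obtain ⟨α, A, ⟨hα, -⟩, h, hh, F, rfl⟩ := hL
  exact ⟨Set α ⊕ Prop, inferInstance, pathDFA h F,
    fun w => (pathDFA_evalFrom_inl hh F w F).symm⟩

theorem AW_pathWordsOf_AW {S : Type} {ar : S → ℕ} (W : Set (List (PathLetter S ar))) :
    AW (pathWordsOf (AW W)) = AW W := by
  ext t
  constructor
  · intro ht w hw
    obtain ⟨s, hs, hsw⟩ := ht w hw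
    exact hs w hsw
  · exact fun ht w hw => ⟨t, ht, hw⟩

/-- For a regular tree language `L`, with
`W_L = {[t,π] : π a root-to-leaf path of some t ∈ L}`: `L` is a universal path
language if and only if `L = A W_L`; moreover, in that case `W_L` is a regular word
language. -/
theorem statement17 {S : Type} {ar : S → ℕ} [Finite S]
    (L : Set (RTree S ar)) (hL : TreeRegular L) :
    (IsUniversalPathLang L ↔ L = AW (pathWordsOf L)) ∧
    (IsUniversalPathLang L → RegularWordLang (pathWordsOf L)) := by
  have hreg := hL.regularWordLang_pathWordsOf
  refine ⟨⟨?_, fun h => ⟨_, hreg, h⟩⟩, fun _ => hreg⟩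
  rintro ⟨W, -, rfl⟩
  exact (AW_pathWordsOf_AW W).symm
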